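/- Let A be a nonsingular 5×5 (−1,1)-matrix. Then |per A| ≤ per D_{(5,4)} (= 24), and equality holds if and only if A can be obtained from D_{(5,4)} by standard transformations. -/

import Mathlib

open Matrix

/-- The permanent of a square matrix. -/
def per {n : ℕ} (A : Matrix (Fin n) (Fin n) ℚ) : ℚ :=
  ∑ σ : Equiv.Perm (Fin n), ∏ i, A i (σ i)

/-- The square matrix `D_{(n,l)}`: `-1` on the first `l` diagonal entries, `1` elsewhere. -/
def Dmat (n l : ℕ) : Matrix (Fin n) (Fin n) ℚ :=
  fun i j => if (i : ℕ) = (j : ℕ) ∧ (j : ℕ) < l then -1 else 1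

/-- `A` is obtained from `B` by standard transformations: a finite composition of row
permutations, column permutations, multiplications of rows/columns by `-1`, and
transposition (square case). -/
def StdEquiv {n : ℕ} (A B : Matrix (Fin n) (Fin n) ℚ) : Prop :=
  ∃ (ρ σ : Equiv.Perm (Fin n)) (ε δ : Fin n → ℚ),
    (∀ i, ε i = 1 ∨ ε i = -1) ∧ (∀ j, δ j = 1 ∨ δ j = -1) ∧
    ((∀ i j, A i j = ε i * δ j * B (ρ i) (σ j)) ∨
     (∀ i j, A i j = ε i * δ j * B (σ j) (ρ i)))

/-- The `j`-th entry of the sign vector whose entry `0` is `1` and whose later entries are given by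
the binary digits of `c`. -/
def signEntry (c : Fin 16) (j : Fin 5) : ℤ :=
  if Nat.testBit (2 * c) j then -1 else 1

/-- The permanent of the `2 × 2` matrix cut out of two rows by columns `i` and `j`. -/
def pairPer {R : Type*} [CommRing R] (p q : Fin 5 → R) (i j : Fin 5) : R :=
  p i * q j + p j * q i

/-- The permanent of the `4 × 4` matrix cut out of four rows by columns `i`, `j`, `k` and `l`. -/
def quadPer {R : Type*} [CommRing R] (b c d e : Fin 5 → R) (i j k l : Fin 5) : R :=
  pairPer b c i j * pairPer d e k l + pairPer b c i k * pairPer d e j l +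
  pairPer b c i l * pairPer d e j k + pairPer b c j k * pairPer d e i l +
  pairPer b c j l * pairPer d e i k + pairPer b c k l * pairPer d e i j

/-- Laplace expansion of a `5 × 5` permanent, with rows `a, …, e`. -/
def rowsPer {R : Type*} [CommRing R] (a b c d e : Fin 5 → R) : R :=
  a 0 * quadPer b c d e 1 2 3 4 + a 1 * quadPer b c d e 0 2 3 4 +
  a 2 * quadPer b c d e 0 1 3 4 + a 3 * quadPer b c d e 0 1 2 4 + a 4 * quadPer b c d e 0 1 2 3

/-- After normalising row `i` and column `j` to be constantly `1`, the entries `-1` of `N` form a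
permutation matrix on the remaining rows and columns. -/
def IsDiagonalAt (N : Fin 5 → Fin 5 → ℤ) (i j : Fin 5) : Prop :=
  (∀ k, k ≠ i → ∃ l, ∀ m, N i j * N k j * N i m * N k m = if m = l then -1 else 1) ∧
    ∀ l, l ≠ j → ∃ k, N i j * N k j * N i l * N k l = -1

instance (N : Fin 5 → Fin 5 → ℤ) (i j : Fin 5) : Decidable (IsDiagonalAt N i j) := by
  unfold IsDiagonalAt; infer_instance

theorem rowsPer_signEntry (a : Fin 16) : 0 < a → ∀ b, a < b → ∀ c, b < c → ∀ d, c < d →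
    (rowsPer (signEntry 0) (signEntry a) (signEntry b) (signEntry c) (signEntry d)).natAbs ≤ 24 ∧
    ((rowsPer (signEntry 0) (signEntry a) (signEntry b) (signEntry c) (signEntry d)).natAbs = 24 →
      ∃ i j, IsDiagonalAt
        ![signEntry 0, signEntry a, signEntry b, signEntry c, signEntry d] i j) := by
  revert a
  decide +kernel

theorem per_succ {n : ℕ} (A : Matrix (Fin (n + 1)) (Fin (n + 1)) ℚ) :
    per A = ∑ p, A 0 p * per (of fun i j => A i.succ (Equiv.swap 0 p j.succ)) := by
  simp only [per]
  rw [← Equiv.sum_comp Equiv.Perm.decomposeFin.symm, Fintype.sum_prod_type]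
  simp [Fin.prod_univ_succ, Finset.mul_sum]

theorem per_eq_rowsPer (A : Matrix (Fin 5) (Fin 5) ℚ) :
    per A = rowsPer (A 0) (A 1) (A 2) (A 3) (A 4) := by
  have h0 (B : Matrix (Fin 0) (Fin 0) ℚ) : per B = 1 := by simp [per]
  simp +decide only [per_succ, h0, Fin.sum_univ_succ, Finset.univ_eq_empty, Finset.sum_empty,
    rowsPer, quadPer, pairPer, Equiv.swap_apply_def, Fin.succ_zero_eq_one, Fin.succ_one_eq_two,
    Fin.reduceSucc, if_true, if_false, of_apply]
  ring

theorem per_smul {n : ℕ} (A : Matrix (Fin n) (Fin n) ℚ) (ε δ : Fin n → ℚ) :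
    per (of fun i j => ε i * δ j * A i j) = (∏ i, ε i) * (∏ j, δ j) * per A := by
  simp only [per, of_apply, Finset.prod_mul_distrib, Finset.mul_sum]
  refine Finset.sum_congr rfl fun σ _ => ?_
  rw [Equiv.prod_comp σ δ]

theorem per_reindex {n : ℕ} (A : Matrix (Fin n) (Fin n) ℚ) (ρ σ : Equiv.Perm (Fin n)) :
    per (of fun i j => A (ρ i) (σ j)) = per A := by
  simp only [per]
  rw [← Equiv.sum_comp ((Equiv.mulLeft σ⁻¹).trans (Equiv.mulRight ρ))]
  refine Finset.sum_congr rfl fun τ _ => ?_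
  rw [← Equiv.prod_comp ρ fun i => A i (τ i)]
  simp

theorem per_transpose {n : ℕ} (A : Matrix (Fin n) (Fin n) ℚ) :
    per (of fun i j => A j i) = per A := by
  simp only [per]
  rw [← Equiv.sum_comp (Equiv.inv _)]
  refine Finset.sum_congr rfl fun τ _ => ?_
  rw [← Equiv.prod_comp τ]
  simp

theorem abs_prod_signs {n : ℕ} {ε : Fin n → ℚ} (hε : ∀ i, ε i = 1 ∨ ε i = -1) :
    |∏ i, ε i| = 1 := by
  rw [Finset.abs_prod]
  exact Finset.prod_eq_one fun i _ => by rcases hε i with h | h <;> simp [h]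

theorem abs_per_smul {n : ℕ} (A : Matrix (Fin n) (Fin n) ℚ) {ε δ : Fin n → ℚ}
    (hε : ∀ i, ε i = 1 ∨ ε i = -1) (hδ : ∀ j, δ j = 1 ∨ δ j = -1) :
    |per (of fun i j => ε i * δ j * A i j)| = |per A| := by
  rw [per_smul, abs_mul, abs_mul, abs_prod_signs hε, abs_prod_signs hδ, one_mul, one_mul]

theorem StdEquiv.abs_per_eq {n : ℕ} {A B : Matrix (Fin n) (Fin n) ℚ} (h : StdEquiv A B) :
    |per A| = |per B| := by
  obtain ⟨ρ, σ, ε, δ, hε, hδ, h | h⟩ := h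
  · obtain rfl : A = of fun i j => ε i * δ j * B (ρ i) (σ j) := by ext i j; exact h i j
    exact (abs_per_smul (of fun i j => B (ρ i) (σ j)) hε hδ).trans (by rw [per_reindex])
  · obtain rfl : A = of fun i j => ε i * δ j * B (σ j) (ρ i) := by ext i j; exact h i j
    exact (abs_per_smul (of fun i j => B (σ j) (ρ i)) hε hδ).trans
      (congrArg abs ((per_reindex (of fun i j => B j i) ρ σ).trans (per_transpose B)))

theorem per_Dmat_five_four : per (Dmat 5 4) = 24 := by
  rw [per_eq_rowsPer]
  norm_num [rowsPer, quadPer, pairPer, Dmat]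

theorem signEntry_eq_or (c : Fin 16) (j : Fin 5) : signEntry c j = 1 ∨ signEntry c j = -1 := by
  unfold signEntry; split <;> simp

theorem exists_signEntry (v : Fin 5 → ℚ) (hv : ∀ j, v j = 1 ∨ v j = -1) (h0 : v 0 = 1) :
    ∃ c, ∀ j, v j = signEntry c j := by
  have key : ∀ b : Fin 4 → Bool, ∃ c, ∀ j : Fin 4, signEntry c j.succ = if b j then -1 else 1 := by
    decide +kernel
  have h0' : ∀ c, signEntry c 0 = 1 := by decide
  obtain ⟨c, hc⟩ := key fun j => decide (v j.succ = -1)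
  refine ⟨c, Fin.cases (by simp [h0, h0']) fun j => ?_⟩
  rw [hc]
  rcases hv j.succ with h | h <;> norm_num [h]

/-- A sign matrix which is diagonal at `(i, j)` arises from `Dmat 5 4` by permutations
and sign changes of rows and columns. -/
theorem IsDiagonalAt.exists_Dmat {N : Fin 5 → Fin 5 → ℤ} (hN : ∀ i j, N i j = 1 ∨ N i j = -1)
    {i j : Fin 5} (h : IsDiagonalAt N i j) :
    ∃ (ρ σ : Equiv.Perm (Fin 5)) (ε δ : Fin 5 → ℚ),
      (∀ k, ε k = 1 ∨ ε k = -1) ∧ (∀ l, δ l = 1 ∨ δ l = -1) ∧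
      ∀ k l, (N k l : ℚ) = ε k * δ l * Dmat 5 4 (ρ k) (σ l) := by
  obtain ⟨hrow, hcol⟩ := h
  have hsq : ∀ k l, N k l * N k l = 1 := fun k l => by rcases hN k l with h | h <;> simp [h]
  choose! f hf using hrow
  let g : Fin 5 → Fin 5 := fun k => if k = i then j else f k
  have hg : ∀ k l, N i j * N k j * N i l * N k l = if k ≠ i ∧ g k = l then -1 else 1 := by
    intro k l
    by_cases hk : k = i
    · subst hk
      simp only [ne_eq, not_true_eq_false, false_and, if_false]
      linear_combination N k l * N k l * hsq k j + hsq k l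
    · simp [g, hk, hf k hk l, eq_comm (a := l)]
  have hsurj : Function.Surjective g := by
    intro l
    by_cases hl : l = j
    · exact ⟨i, by simp [g, hl]⟩
    · obtain ⟨k, hk⟩ := hcol l hl
      rw [hg] at hk
      refine ⟨k, ?_⟩
      by_contra hne
      simp [hne] at hk
  let τ : Equiv.Perm (Fin 5) :=
    Equiv.ofBijective g ⟨Finite.injective_iff_surjective.mpr hsurj, hsurj⟩
  have hcast : ∀ k l, (N k l : ℚ) = 1 ∨ (N k l : ℚ) = -1 := fun k l => by
    rcases hN k l with h | h <;> simp [h]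
  refine ⟨Equiv.swap i 4, τ.symm.trans (Equiv.swap i 4), fun k => N i j * N k j, fun l => N i l,
    fun k => ?_, fun l => hcast i l, fun k l => ?_⟩
  · rcases hcast i j with h | h <;> rcases hcast k j with h' | h' <;> simp [h, h']
  · have hD : Dmat 5 4 (Equiv.swap i 4 k) (τ.symm.trans (Equiv.swap i 4) l) =
        ((if k ≠ i ∧ g k = l then -1 else 1 : ℤ) : ℚ) := by
      have h4 : ∀ x : Fin 5, (x : ℕ) < 4 ↔ x ≠ 4 := by decide
      have hiff : (k = τ.symm l ∧ Equiv.swap i 4 (τ.symm l) ≠ 4) ↔ (k ≠ i ∧ g k = l) := by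
        rw [Equiv.eq_symm_apply]
        refine ⟨fun ⟨h, h'⟩ => ⟨?_, h⟩, fun ⟨h, h'⟩ => ⟨h', ?_⟩⟩
        · rintro rfl
          simp [← h] at h'
        · have : τ.symm l = k := by rw [Equiv.symm_apply_eq]; exact h'.symm
          rw [this]
          intro h5
          exact h ((Equiv.swap i 4).injective (h5.trans (Equiv.swap_apply_left i 4).symm))
      simp only [Dmat, Fin.val_inj, h4, Equiv.trans_apply, EmbeddingLike.apply_eq_iff_eq, hiff]
      push_cast
      rfl
    rw [hD, ← hg]
    have h1 : (N i j * N i j : ℚ) = 1 := mod_cast hsq i j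
    have h2 : (N k j * N k j : ℚ) = 1 := mod_cast hsq k j
    have h3 : (N i l * N i l : ℚ) = 1 := mod_cast hsq i l
    push_cast
    linear_combination -(N k l : ℚ) * (h1 + (N i j * N i j : ℚ) * h2 +
      (N i j * N i j * (N k j * N k j) : ℚ) * h3)

/-- Normal form of a nonsingular sign matrix: up to row permutations and sign changes, its rows are
`signEntry` vectors with strictly increasing codes, starting with the constant row. -/
theorem exists_signEntry_normal_form (A : Matrix (Fin 5) (Fin 5) ℚ)
    (hA : ∀ i j, A i j = 1 ∨ A i j = -1) (hdet : A.det ≠ 0) :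
    ∃ (ρ : Equiv.Perm (Fin 5)) (ε δ : Fin 5 → ℚ) (c : Fin 5 → Fin 16),
      (∀ k, ε k = 1 ∨ ε k = -1) ∧ (∀ l, δ l = 1 ∨ δ l = -1) ∧ StrictMono c ∧ c 0 = 0 ∧
      ∀ k l, A k l = ε k * δ l * signEntry (c (ρ k)) l := by
  have hsq : ∀ k l, A k l * A k l = 1 := fun k l => by rcases hA k l with h | h <;> simp [h]
  have hcode : ∀ i, ∃ c, ∀ j, A i 0 * (A 0 0 * A 0 j) * A i j = signEntry c j := by
    intro i
    refine exists_signEntry (fun j => A i 0 * (A 0 0 * A 0 j) * A i j) (fun j => ?_) ?_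
    · rcases hA i 0 with h | h <;> rcases hA 0 0 with h' | h' <;> rcases hA 0 j with h2 | h2 <;>
        rcases hA i j with h3 | h3 <;> simp [h, h', h2, h3]
    · linear_combination A 0 0 * A 0 0 * hsq i 0 + hsq 0 0
  choose c hc using hcode
  have hAc : ∀ k l, A k l = A k 0 * (A 0 0 * A 0 l) * signEntry (c k) l := by
    intro k l
    rw [← hc]
    linear_combination -A k l * (hsq k 0 + A k 0 * A k 0 * hsq 0 0 +
      A k 0 * A k 0 * (A 0 0 * A 0 0) * hsq 0 l)
  have hinj : Function.Injective c := by
    intro i k hik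
    by_contra hne
    apply hdet
    have hrow : A = of fun k l =>
        A k 0 * of (fun k l => A 0 0 * A 0 l * signEntry (c k) l) k l := by
      ext k l
      rw [of_apply, of_apply, hAc k l]
      ring
    rw [hrow, Matrix.det_mul_column, Matrix.det_zero_of_row_eq hne, mul_zero]
    ext l
    simp [hik]
  have hc0 : c 0 = 0 := by
    have key : ∀ c, (∀ j, signEntry c j = 1) → c = 0 := by decide
    refine key _ fun j => ?_
    have : (signEntry (c 0) j : ℚ) = 1 := by
      rw [← hc]
      linear_combination A 0 j * A 0 j * hsq 0 0 + hsq 0 j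
    exact_mod_cast this
  let σ := Tuple.sort c
  have hmono : StrictMono (c ∘ σ) :=
    (Tuple.monotone_sort c).strictMono_of_injective (hinj.comp σ.injective)
  refine ⟨σ.symm, fun k => A k 0, fun l => A 0 0 * A 0 l, c ∘ σ, fun k => hA k 0, fun l => ?_,
    hmono, ?_, fun k l => by simpa using hAc k l⟩
  · rcases hA 0 0 with h | h <;> rcases hA 0 l with h' | h' <;> simp [h, h']
  · have := hmono.monotone (Fin.zero_le (σ.symm 0))
    simpa [hc0] using this

theorem order_five_nonsingular (A : Matrix (Fin 5) (Fin 5) ℚ)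
    (hA : ∀ i j, A i j = 1 ∨ A i j = -1) (hdet : A.det ≠ 0) :
    |per A| ≤ per (Dmat 5 4) ∧ per (Dmat 5 4) = 24 ∧
      (|per A| = per (Dmat 5 4) ↔ StdEquiv A (Dmat 5 4)) := by
  have hD := per_Dmat_five_four
  obtain ⟨ρ, ε, δ, c, hε, hδ, hc, hc0, h⟩ := exists_signEntry_normal_form A hA hdet
  have key := rowsPer_signEntry (c 1) (hc0 ▸ hc (by decide)) (c 2) (hc (by decide)) (c 3)
    (hc (by decide)) (c 4) (hc (by decide))
  set P := rowsPer (signEntry 0) (signEntry (c 1)) (signEntry (c 2)) (signEntry (c 3))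
    (signEntry (c 4)) with hP
  have hper : |per A| = P.natAbs := by
    obtain rfl : A = of fun k l => ε k * δ l * signEntry (c (ρ k)) l := by ext k l; exact h k l
    refine (abs_per_smul (of fun k l => (signEntry (c (ρ k)) l : ℚ)) hε hδ).trans ?_
    have hρ := per_reindex (of fun k l => (signEntry (c k) l : ℚ)) ρ 1
    simp only [of_apply, Equiv.Perm.one_apply] at hρ
    rw [hρ, per_eq_rowsPer, Nat.cast_natAbs, Int.cast_abs, hP]
    simp [rowsPer, quadPer, pairPer, hc0]
  refine ⟨?_, hD, fun h24 => ?_, fun hequiv => ?_⟩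
  · rw [hper, hD]
    exact_mod_cast key.1
  · rw [hper, hD] at h24
    obtain ⟨i, j, hij⟩ := key.2 (by exact_mod_cast h24)
    have hN : ![signEntry 0, signEntry (c 1), signEntry (c 2), signEntry (c 3), signEntry (c 4)] =
        fun k => signEntry (c k) := by
      ext k
      fin_cases k <;> simp [hc0]
    rw [hN] at hij
    obtain ⟨ρ', σ', ε', δ', hε', hδ', h'⟩ := hij.exists_Dmat fun k l => signEntry_eq_or (c k) l
    refine ⟨ρ.trans ρ', σ', fun k => ε k * ε' (ρ k), fun l => δ l * δ' l, fun k => ?_, fun l => ?_,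
      Or.inl fun k l => ?_⟩
    · rcases hε k with h1 | h1 <;> rcases hε' (ρ k) with h2 | h2 <;> simp [h1, h2]
    · rcases hδ l with h1 | h1 <;> rcases hδ' l with h2 | h2 <;> simp [h1, h2]
    · rw [h, h', Equiv.trans_apply]
      ring
  · rw [hequiv.abs_per_eq, hD]
    norm_num
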